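/- Let z₁ < z₂ and let B be a rate two Brownian bridge on [z₁, z₂] whose endpoint values are at least −z₁²+1 and −z₂²+1 respectively. Then for all z₂−z₁ sufficiently large, P(B(x) > −x² for all x ∈ [z₁, z₂]) ≥ exp(−(1/12)(z₂−z₁)³ − 2(z₂−z₁)·log(z₂−z₁)). -/

import Mathlib

open MeasureTheory ProbabilityTheory Real

/-- A Brownian bridge of rate `rate` on `[a,b]` with zero endpoint values:
a centered continuous Gaussian process with the Brownian bridge covariance. -/
structure IsBrownianBridge {Ω : Type} [MeasureSpace Ω] (rate a b : ℝ)
    (B : ℝ → Ω → ℝ) : Prop where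
  measurable : ∀ t, Measurable (B t)
  cont : ∀ ω, Continuous fun t => B t ω
  endpoint_left : ∀ ω, B a ω = 0
  endpoint_right : ∀ ω, B b ω = 0
  gaussian_combos : ∀ (n : ℕ) (ts cs : Fin n → ℝ), ∃ (m : ℝ) (v : NNReal),
      Measure.map (fun ω => ∑ i, cs i * B (ts i) ω) volume = gaussianReal m v
  mean_zero : ∀ t, ∫ ω, B t ω = 0
  covariance : ∀ s t, a ≤ s → s ≤ t → t ≤ b →
      ∫ ω, B s ω * B t ω = rate * ((s - a) * (b - t) / (b - a))


lemma gr_real_Icc (v : NNReal) (hv : v ≠ 0) (c d : ℝ) (h : c ≤ d) :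
    (gaussianReal 0 v).real (Set.Icc c d) = ∫ x in c..d, gaussianPDFReal 0 v x := by
  rw [measureReal_def, gaussianReal_apply_eq_integral _ hv, ENNReal.toReal_ofReal,
    intervalIntegral.integral_of_le h, integral_Icc_eq_integral_Ioc]
  exact integral_nonneg (gaussianPDFReal_nonneg _ _)

lemma gr_cont (v : NNReal) : Continuous (gaussianPDFReal 0 v) := by
  unfold gaussianPDFReal
  fun_prop

lemma gr_shift (v : NNReal) (hv : v ≠ 0) (m b : ℝ) (hb : 0 ≤ b) :
    exp (-m ^ 2 / (2 * v)) * (gaussianReal 0 v).real (Set.Icc (-b) b) ≤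
      (gaussianReal 0 v).real (Set.Icc (m - b) (m + b)) := by
  rw [gr_real_Icc v hv _ _ (by linarith), gr_real_Icc v hv _ _ (by linarith)]
  have hvp : (0 : ℝ) < v := by positivity
  have hc := gr_cont v
  have e1 : ∫ x in (m - b)..(m + b), gaussianPDFReal 0 v x
      = ∫ y in (-b)..b, gaussianPDFReal 0 v (y + m) := by
    rw [intervalIntegral.integral_comp_add_right]
    congr 1 <;> ring
  have odd : ∫ y in (-b)..b, (m / v) * (y * gaussianPDFReal 0 v y) = 0 := by
    have h1 := intervalIntegral.integral_comp_neg (a := -b) (b := b)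
      (fun y => (m / v) * (y * gaussianPDFReal 0 v y))
    have h2 : (fun y : ℝ => (m / v) * (-y * gaussianPDFReal 0 v (-y)))
        = fun y => -((m / v) * (y * gaussianPDFReal 0 v y)) := by
      funext y
      have : gaussianPDFReal 0 v (-y) = gaussianPDFReal 0 v y := by
        simp [gaussianPDFReal]
      rw [this]; ring
    rw [h2, intervalIntegral.integral_neg, neg_neg] at h1
    linarith
  have e2 : ∫ y in (-b)..b, gaussianPDFReal 0 v y
      = ∫ y in (-b)..b, (gaussianPDFReal 0 v y - (m / v) * (y * gaussianPDFReal 0 v y)) := by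
    rw [intervalIntegral.integral_sub, odd, sub_zero]
    · exact hc.intervalIntegrable _ _
    · exact Continuous.intervalIntegrable (by fun_prop) _ _
  rw [e1, e2, ← intervalIntegral.integral_const_mul]
  apply intervalIntegral.integral_mono_on (by linarith)
  · exact Continuous.intervalIntegrable (by fun_prop) _ _
  · exact Continuous.intervalIntegrable (by fun_prop) _ _
  intro y _
  have key : gaussianPDFReal 0 v (y + m)
      = exp (-m ^ 2 / (2 * v)) * (gaussianPDFReal 0 v y * exp (-(m / v * y))) := by
    simp only [gaussianPDFReal]
    have h : exp (-(y + m - 0) ^ 2 / (2 * v))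
        = exp (-m ^ 2 / (2 * v)) * (exp (-(y - 0) ^ 2 / (2 * v)) * exp (-(m / v * y))) := by
      rw [← Real.exp_add, ← Real.exp_add]
      congr 1
      field_simp
      ring
    rw [h]; ring
  rw [key]
  have h3 := Real.add_one_le_exp (-(m / v * y))
  have h4 := gaussianPDFReal_nonneg 0 v y
  apply mul_le_mul_of_nonneg_left _ (Real.exp_pos _).le
  nlinarith

lemma gr_lower1 (v : NNReal) (hv : v ≠ 0) (b : ℝ) (hb : 0 ≤ b) :
    2 * b * gaussianPDFReal 0 v b ≤ (gaussianReal 0 v).real (Set.Icc (-b) b) := by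
  rw [gr_real_Icc v hv _ _ (by linarith)]
  have : 2 * b * gaussianPDFReal 0 v b = ∫ y in (-b)..b, gaussianPDFReal 0 v b := by
    rw [intervalIntegral.integral_const, smul_eq_mul]; ring
  rw [this]
  apply intervalIntegral.integral_mono_on (by linarith)
  · simp
  · exact (gr_cont v).intervalIntegrable _ _
  intro y hy
  have hvp : (0 : ℝ) < v := by positivity
  simp only [gaussianPDFReal]
  have hsq : y ^ 2 ≤ b ^ 2 := sq_le_sq' hy.1 hy.2
  simp only [sub_zero]
  gcongr

lemma gr_lower2 (v : NNReal) (b : ℝ) (hb : 0 ≤ b) :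
    1 - 2 * exp (-b ^ 2 / (2 * v)) ≤ (gaussianReal 0 v).real (Set.Icc (-b) b) := by
  have s1 : HasSubgaussianMGF (fun x : ℝ => x) v (gaussianReal 0 v) :=
    ⟨fun t => integrable_exp_mul_gaussianReal t, fun t => by
      rw [mgf_fun_id_gaussianReal]; simp⟩
  have h1 := s1.measure_ge_le hb
  have h2 := s1.neg.measure_ge_le hb
  have h3 : (Set.univ : Set ℝ) ⊆ Set.Icc (-b) b ∪ ({x | b ≤ x} ∪ {x | b ≤ -x}) := by
    intro x _
    by_cases h : b ≤ x
    · right; left; exact h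
    by_cases h' : b ≤ -x
    · right; right; exact h'
    left; constructor <;> linarith
  have h4 := measureReal_mono (μ := gaussianReal 0 v) h3
  have h5 := measureReal_union_le (μ := gaussianReal 0 v) (Set.Icc (-b) b)
    ({x | b ≤ x} ∪ {x | b ≤ -x})
  have h6 := measureReal_union_le (μ := gaussianReal 0 v) {x | b ≤ x} {x | b ≤ -x}
  have h7 : (gaussianReal 0 v).real Set.univ = 1 := by simp
  simp only [Pi.neg_apply] at h2
  linarith

lemma gr_small (v : NNReal) (hv : v ≠ 0) (b x : ℝ) (hx : 0 < x) (hbx : b = x * √v) :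
    exp (-(486 / x)) ≤ (gaussianReal 0 v).real (Set.Icc (-b) b) ∧
    exp (-(486 / x ^ 4)) ≤ (gaussianReal 0 v).real (Set.Icc (-b) b) := by
  have hvp : (0 : ℝ) < v := by positivity
  have hs : 0 < √(v : ℝ) := Real.sqrt_pos.2 hvp
  have hss : √(v : ℝ) ^ 2 = v := Real.sq_sqrt hvp.le
  have hb : 0 ≤ b := by rw [hbx]; positivity
  have hbb : -b ^ 2 / (2 * (v : ℝ)) = -(x ^ 2 / 2) := by
    rw [hbx, mul_pow, hss]; field_simp
  rcases le_total x 3 with h3 | h3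
  · have h1 := gr_lower1 v hv b hb
    have h2 : exp (-(11/2 + 1 / x)) ≤ 2 * b * gaussianPDFReal 0 v b := by
      simp only [gaussianPDFReal, sub_zero]
      rw [hbb, Real.sqrt_mul (by positivity), hbx]
      have e : 2 * (x * √(v : ℝ)) * ((√(2 * π) * √(v : ℝ))⁻¹ * exp (-(x ^ 2 / 2)))
          = 2 / √(2 * π) * x * exp (-(x ^ 2 / 2)) := by
        field_simp
      rw [e]
      have p1 : exp (-1) ≤ 2 / √(2 * π) := by
        have : √(2 * π) ≤ 3 := by
          rw [Real.sqrt_le_left (by norm_num)]; linarith [Real.pi_lt_four]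
        have h' : exp (-1) ≤ 1 / 2 := by
          rw [Real.exp_neg, one_div]
          apply inv_anti₀ (by norm_num)
          linarith [Real.add_one_le_exp (1 : ℝ)]
        have : 2 / 3 ≤ 2 / √(2 * π) := by gcongr
        linarith
      have p2 : exp (-(1 / x)) ≤ x := by
        rw [Real.exp_neg]
        apply inv_le_of_inv_le₀ hx
        have := Real.add_one_le_exp (1 / x)
        rw [← one_div]; linarith
      have p3 : exp (-(9 / 2)) ≤ exp (-(x ^ 2 / 2)) := by
        apply Real.exp_le_exp.2; nlinarith
      calc exp (-(11/2 + 1 / x)) = exp (-1) * exp (-(1 / x)) * exp (-(9 / 2)) := by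
            rw [← Real.exp_add, ← Real.exp_add]; ring_nf
        _ ≤ _ := by gcongr
    have h4 : 11/2 + 1 / x ≤ 18 / x := by
      have : 18 / x = 1 / x + 17 / x := by ring
      rw [this]
      have : 11 / 2 ≤ 17 / x := by rw [le_div_iff₀ hx]; linarith
      linarith
    have h5 : 18 / x ≤ 486 / x := by gcongr; norm_num
    have h6 : 18 / x ≤ 486 / x ^ 4 := by
      rw [div_le_div_iff₀ hx (by positivity)]
      have : x ^ 3 ≤ 27 := by
        calc x ^ 3 ≤ 3 ^ 3 := by gcongr
          _ = 27 := by norm_num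
      nlinarith
    constructor
    · refine le_trans (Real.exp_le_exp.2 ?_) (h2.trans h1); linarith
    · refine le_trans (Real.exp_le_exp.2 ?_) (h2.trans h1); linarith
  · have h1 := gr_lower2 v b hb
    rw [hbb] at h1
    have h2 : exp (-(x ^ 2 / 2)) ≤ 8 / x ^ 4 := by
      rw [Real.exp_neg]
      apply inv_le_of_inv_le₀ (by positivity)
      have := Real.quadratic_le_exp_of_nonneg (x := x ^ 2 / 2) (by positivity)
      have e : (8 / x ^ 4)⁻¹ = (x ^ 2 / 2) ^ 2 / 2 := by field_simp; norm_num
      rw [e]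
      have : 0 ≤ x ^ 2 / 2 := by positivity
      linarith
    have hx4 : x ^ 4 ≥ 81 := by
      calc x ^ 4 ≥ 3 ^ 4 := by gcongr
        _ = 81 := by norm_num
    have hu : 16 / x ^ 4 ≤ 1 / 2 := by
      rw [div_le_div_iff₀ (by positivity) (by norm_num)]; linarith
    have hu0 : 0 ≤ 16 / x ^ 4 := by positivity
    have h3' : exp (-(32 / x ^ 4)) ≤ 1 - 16 / x ^ 4 := by
      have e : 32 / x ^ 4 = 2 * (16 / x ^ 4) := by ring
      rw [e]
      set u := 16 / x ^ 4
      rw [Real.exp_neg]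
      apply inv_le_of_inv_le₀ (by linarith)
      have := Real.add_one_le_exp (2 * u)
      refine le_trans ?_ this
      rw [inv_le_iff_one_le_mul₀ (by linarith)]
      nlinarith
    have h4 : exp (-(32 / x ^ 4)) ≤ (gaussianReal 0 v).real (Set.Icc (-b) b) := by
      refine h3'.trans (le_trans ?_ h1)
      have : 16 / x ^ 4 = 2 * (8 / x ^ 4) := by ring
      linarith
    constructor
    · refine le_trans (Real.exp_le_exp.2 ?_) h4
      rw [neg_le_neg_iff, div_le_div_iff₀ (by positivity) hx]
      have : x ^ 3 ≥ 3 ^ 3 := by gcongr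
      nlinarith
    · refine le_trans (Real.exp_le_exp.2 ?_) h4
      rw [neg_le_neg_iff]; gcongr; norm_num


/-- dyadic grid -/
noncomputable def grd (a l : ℝ) (k j : ℕ) : ℝ := a + l * (j / 2 ^ k)

lemma grd_even (a l : ℝ) (k j : ℕ) : grd a l (k + 1) (2 * j) = grd a l k j := by
  unfold grd; push_cast; rw [pow_succ]; field_simp

lemma det_grid (f : ℝ → ℝ) (a l : ℝ) (β : ℕ → ℝ) (hβ : ∀ k, 0 ≤ β k)
    (ha : f a = 0) (hb : f (a + l) = 0) (n : ℕ)
    (h : ∀ k < n, ∀ j < 2 ^ k, |f (grd a l (k + 1) (2 * j + 1))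
      - (f (grd a l k j) + f (grd a l k (j + 1))) / 2| ≤ β k) :
    ∀ i ≤ 2 ^ n, |f (grd a l n i)| ≤ ∑ k ∈ Finset.range n, β k := by
  induction n with
  | zero =>
    intro i hi
    have : i = 0 ∨ i = 1 := by simp at hi; omega
    rcases this with rfl | rfl <;> simp [grd, ha, hb]
  | succ n ih =>
    intro i hi
    have ih' := ih (fun k hk => h k (by omega))
    rw [Finset.sum_range_succ]
    rcases Nat.even_or_odd' i with ⟨j, rfl | rfl⟩
    · rw [grd_even]
      have := ih' j (by rw [pow_succ] at hi; omega)
      linarith [hβ n]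
    · have hj : j < 2 ^ n := by rw [pow_succ] at hi; omega
      have h1 := ih' j hj.le
      have h2 := ih' (j + 1) hj
      have h3 := h n (by omega) j hj
      rw [abs_le] at *
      constructor <;> linarith [h1.1, h1.2, h2.1, h2.2, h3.1, h3.2]

lemma det_cont (f : ℝ → ℝ) (hf : Continuous f) (a l c : ℝ) (hl : 0 < l)
    (h : ∀ n : ℕ, ∀ i ≤ 2 ^ n, |f (grd a l n i)| ≤ c) :
    ∀ s ∈ Set.Icc a (a + l), |f s| ≤ c := by
  intro s hs
  set u := (s - a) / l with hu
  have hu0 : 0 ≤ u := div_nonneg (by linarith [hs.1]) hl.le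
  have hu1 : u ≤ 1 := by rw [hu, div_le_one hl]; linarith [hs.2]
  have hsu : s = a + l * u := by rw [hu]; field_simp; ring
  have t1 : Filter.Tendsto (fun n : ℕ => (⌊u * (2 : ℝ) ^ n⌋₊ : ℝ) / 2 ^ n) Filter.atTop (nhds u) :=
    (tendsto_nat_floor_mul_div_atTop hu0).comp
      (tendsto_pow_atTop_atTop_of_one_lt (by norm_num : (1 : ℝ) < 2))
  have t2 : Filter.Tendsto (fun n : ℕ => |f (grd a l n ⌊u * (2 : ℝ) ^ n⌋₊)|) Filter.atTop
      (nhds |f s|) := by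
    have hc : Continuous fun w : ℝ => |f (a + l * w)| := by fun_prop
    rw [hsu]
    exact (hc.tendsto u).comp t1
  refine le_of_tendsto' t2 fun n => h n _ ?_
  have : ((⌊u * (2 : ℝ) ^ n⌋₊ : ℕ) : ℝ) ≤ 2 ^ n := by
    refine (Nat.floor_le (by positivity)).trans ?_
    have : (0 : ℝ) < 2 ^ n := by positivity
    nlinarith
  exact_mod_cast this

lemma sum_two_sided (r : ℝ) (h0 : 0 < r) (h1 : r < 1) (K n : ℕ) :
    ∑ k ∈ Finset.range n, r ^ ((k - K) + (K - k)) ≤ 2 / (1 - r) := by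
  have g : ∀ n, ∑ i ∈ Finset.range n, r ^ i ≤ 1 / (1 - r) := by
    intro n
    have := (summable_geometric_of_lt_one h0.le h1).sum_le_tsum (Finset.range n)
      (fun i _ => by positivity)
    rwa [tsum_geometric_of_lt_one h0.le h1, ← one_div] at this
  calc ∑ k ∈ Finset.range n, r ^ ((k - K) + (K - k))
      ≤ ∑ k ∈ Finset.range (K + n), r ^ ((k - K) + (K - k)) := by
        apply Finset.sum_le_sum_of_subset_of_nonneg
        · intro i; simp; omega
        · intros; positivity
    _ = ∑ k ∈ Finset.range K, r ^ ((k - K) + (K - k)) + ∑ i ∈ Finset.range n, r ^ i := by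
        rw [Finset.sum_range_add]
        congr 1
        apply Finset.sum_congr rfl
        intro i _
        congr 1; omega
    _ ≤ ∑ i ∈ Finset.range K, r ^ i + ∑ i ∈ Finset.range n, r ^ i := by
        gcongr ?_ + _
        rw [← Finset.sum_range_reflect (fun i => r ^ i)]
        apply Finset.sum_le_sum
        intro i hi
        apply pow_le_pow_of_le_one h0.le h1.le
        omega
    _ ≤ 1 / (1 - r) + 1 / (1 - r) := add_le_add (g _) (g _)
    _ = 2 / (1 - r) := by ring

/-- widths -/
noncomputable def wid (K k : ℕ) : ℝ := 1 / 40 * (9 / 10) ^ ((k - K) + (K - k))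

lemma wid_pos (K k : ℕ) : 0 < wid K k := by unfold wid; positivity

lemma wid_sum (K n : ℕ) : ∑ k ∈ Finset.range n, wid K k ≤ 1 / 2 := by
  unfold wid
  rw [← Finset.mul_sum]
  have := sum_two_sided (9 / 10) (by norm_num) (by norm_num) K n
  norm_num at this ⊢
  linarith

lemma cost_level (l : ℝ) (hl : 0 < l) (K k : ℕ) (hK : l ≤ 2 ^ (K + 1)) :
    ∃ c : ℝ, (c = 486 * (√(l / 2 ^ k / 2) / wid K k) ∨ c = 486 * (√(l / 2 ^ k / 2) / wid K k) ^ 4) ∧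
      2 ^ k * c ≤ 486 * 40 ^ 4 * 2 ^ K * (4 / 5) ^ ((k - K) + (K - k)) := by
  have h2 : l / 2 ≤ 2 ^ K := by rw [pow_succ] at hK; linarith
  rcases le_total k K with h | h
  · refine ⟨_, Or.inl rfl, ?_⟩
    obtain ⟨i, rfl⟩ := Nat.exists_eq_add_of_le h
    have e : (k - (k + i)) + (k + i - k) = i := by omega
    rw [wid, e]
    have s1 : √(l / 2 ^ k / 2) ≤ (36 / 25) ^ i := by
      apply Real.sqrt_le_iff.2
      refine ⟨by positivity, ?_⟩
      calc l / 2 ^ k / 2 = (l / 2) / 2 ^ k := by ring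
        _ ≤ 2 ^ (k + i) / 2 ^ k := by gcongr
        _ = 2 ^ i := by rw [pow_add]; field_simp
        _ ≤ ((36 / 25) ^ 2) ^ i := by gcongr; norm_num
        _ = _ := by rw [← pow_mul, ← pow_mul, mul_comm]
    calc 2 ^ k * (486 * (√(l / 2 ^ k / 2) / (1 / 40 * (9 / 10) ^ i)))
        ≤ 2 ^ k * (486 * ((36 / 25) ^ i / (1 / 40 * (9 / 10) ^ i))) := by gcongr
      _ = 486 * 40 * 2 ^ k * ((36 / 25) ^ i / (9 / 10) ^ i) := by field_simp
      _ = 486 * 40 * 2 ^ k * (2 * (4 / 5)) ^ i := by rw [← div_pow]; norm_num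
      _ = 486 * 40 * 2 ^ (k + i) * (4 / 5) ^ i := by rw [mul_pow, pow_add]; ring
      _ ≤ _ := by gcongr; norm_num
  · refine ⟨_, Or.inr rfl, ?_⟩
    obtain ⟨i, rfl⟩ := Nat.exists_eq_add_of_le h
    have e : (K + i - K) + (K - (K + i)) = i := by omega
    rw [wid, e]
    have s1 : √(l / 2 ^ (K + i) / 2) ^ 4 ≤ ((1 / 2) ^ i) ^ 2 := by
      have : √(l / 2 ^ (K + i) / 2) ^ 4 = (√(l / 2 ^ (K + i) / 2) ^ 2) ^ 2 := by ring
      rw [this, Real.sq_sqrt (by positivity)]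
      gcongr
      calc l / 2 ^ (K + i) / 2 = (l / 2) / 2 ^ (K + i) := by ring
        _ ≤ 2 ^ K / 2 ^ (K + i) := by gcongr
        _ = (1 / 2) ^ i := by rw [pow_add, div_pow]; field_simp; simp
    rw [div_pow]
    calc 2 ^ (K + i) * (486 * (√(l / 2 ^ (K + i) / 2) ^ 4 / (1 / 40 * (9 / 10) ^ i) ^ 4))
        ≤ 2 ^ (K + i) * (486 * (((1 / 2) ^ i) ^ 2 / (1 / 40 * (9 / 10) ^ i) ^ 4)) := by gcongr
      _ = 486 * 40 ^ 4 * 2 ^ K * ((2 * (1 / 2) ^ 2 / (9 / 10) ^ 4) ^ i) := by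
          have e' : (2 * (1 / 2) ^ 2 / (9 / 10) ^ 4 : ℝ) ^ i
              = 2 ^ i * ((1 / 2) ^ i) ^ 2 / ((9 / 10) ^ i) ^ 4 := by
            rw [div_pow, mul_pow, pow_right_comm, pow_right_comm (9 / 10 : ℝ)]
          rw [e', mul_pow, pow_add]
          field_simp
      _ ≤ _ := by
          apply mul_le_mul_of_nonneg_left _ (by positivity)
          exact pow_le_pow_left₀ (by positivity) (by norm_num) _

section bridge
variable {Ω : Type} [MeasureSpace Ω] [IsProbabilityMeasure (volume : Measure Ω)]
  {a b : ℝ} {B : ℝ → Ω → ℝ}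

lemma bb_process (h : IsBrownianBridge 2 a b B) : IsGaussianProcess B volume where
  hasGaussianLaw I := by
    refine ⟨isGaussian_of_map_eq_gaussianReal fun L => ?_⟩
    let e := Fintype.equivFin I
    classical
    obtain ⟨m, v, hmv⟩ := h.gaussian_combos (Fintype.card I) (fun i => (e.symm i : ℝ))
      (fun i => L (Pi.single (e.symm i) 1))
    refine ⟨m, v, ?_⟩
    have hm : Measurable (fun ω => I.restrict (fun t => B t ω)) := by
      apply measurable_pi_lambda
      intro i
      exact h.measurable i
    rw [Measure.map_map L.continuous.measurable hm, ← hmv]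
    congr 1
    funext ω
    simp only [Function.comp_apply]
    have : I.restrict (fun t => B t ω) = ∑ i : I, B i ω • (Pi.single i 1 : I → ℝ) := by
      funext j
      simp [Finset.sum_apply, Pi.single_apply]
    rw [this, map_sum, ← e.symm.sum_comp]
    simp [mul_comm]

/-- Schauder coefficient -/
noncomputable def sch (B : ℝ → Ω → ℝ) (a l : ℝ) (p : ℕ × ℕ) (ω : Ω) : ℝ :=
  B (grd a l (p.1 + 1) (2 * p.2 + 1)) ω
    - (B (grd a l p.1 p.2) ω + B (grd a l p.1 (p.2 + 1)) ω) / 2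

lemma sch_process (hB : IsGaussianProcess B (volume : Measure Ω)) (l : ℝ) :
    IsGaussianProcess (sch B a l) (volume : Measure Ω) := by
  classical
  refine hB.of_isGaussianProcess fun p => ?_
  refine ⟨{grd a l (p.1 + 1) (2 * p.2 + 1), grd a l p.1 p.2, grd a l p.1 (p.2 + 1)},
    ContinuousLinearMap.proj ⟨grd a l (p.1 + 1) (2 * p.2 + 1), by simp⟩
     - (1 / 2 : ℝ) • (ContinuousLinearMap.proj ⟨grd a l p.1 p.2, by simp⟩
      + ContinuousLinearMap.proj ⟨grd a l p.1 (p.2 + 1), by simp⟩), fun ω => ?_⟩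
  simp [sch]
  ring

lemma cov_B (h : IsBrownianBridge 2 a b B) (s t : ℝ) (h1 : a ≤ s) (h2 : s ≤ t) (h3 : t ≤ b) :
    cov[B s, B t] = 2 * ((s - a) * (b - t) / (b - a)) := by
  have hB := bb_process h
  rw [covariance_eq_sub (hB.hasGaussianLaw_eval s).memLp_two (hB.hasGaussianLaw_eval t).memLp_two,
    h.mean_zero s]
  have := h.covariance s t h1 h2 h3
  simpa using this

lemma cov_sch_right (h : IsBrownianBridge 2 a b B) (X : Ω → ℝ) (hX : MemLp X 2 volume)
    (l : ℝ) (p : ℕ × ℕ) :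
    cov[X, sch B a l p] = cov[X, B (grd a l (p.1 + 1) (2 * p.2 + 1))]
      - (cov[X, B (grd a l p.1 p.2)] + cov[X, B (grd a l p.1 (p.2 + 1))]) / 2 := by
  have hB := bb_process h
  have hm := fun t => (hB.hasGaussianLaw_eval t).memLp_two
  have e : sch B a l p = B (grd a l (p.1 + 1) (2 * p.2 + 1))
      - (1 / 2 : ℝ) • (B (grd a l p.1 p.2) + B (grd a l p.1 (p.2 + 1))) := by
    funext ω; simp [sch]; ring
  rw [e, covariance_sub_right hX (hm _) (((hm _).add (hm _)).const_smul _),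
    covariance_smul_right, covariance_add_right hX (hm _) (hm _)]
  ring

lemma grd_mem (l : ℝ) (hl : 0 < l) (k j : ℕ) (hj : j ≤ 2 ^ k) :
    a ≤ grd a l k j ∧ grd a l k j ≤ a + l := by
  unfold grd
  have : (j : ℝ) ≤ 2 ^ k := by exact_mod_cast hj
  have h1 : (j : ℝ) / 2 ^ k ≤ 1 := by rw [div_le_one (by positivity)]; exact this
  constructor
  · have : 0 ≤ l * (j / 2 ^ k) := by positivity
    linarith
  · nlinarith

lemma grd_mono (l : ℝ) (hl : 0 < l) (k i j : ℕ) (hj : i ≤ j) :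
    grd a l k i ≤ grd a l k j := by
  unfold grd
  gcongr

lemma grd_mid (l : ℝ) (k j : ℕ) :
    grd a l (k + 1) (2 * j + 1) = (grd a l k j + grd a l k (j + 1)) / 2 := by
  unfold grd; push_cast; rw [pow_succ]; field_simp; ring

lemma grd_refine (l : ℝ) (k d j : ℕ) : grd a l k j = grd a l (k + d) (2 ^ d * j) := by
  unfold grd; push_cast; rw [pow_add]; field_simp

/-- a point outside the open dyadic interval is uncorrelated with the coefficient -/
lemma cov_point (l : ℝ) (hl : 0 < l) (h : IsBrownianBridge 2 a (a + l) B) (p : ℕ × ℕ)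
    (hp : p.2 < 2 ^ p.1) (i : ℕ) (hi : i ≤ 2 ^ p.1) :
    cov[B (grd a l p.1 i), sch B a l p] = 0 := by
  have hB := bb_process h
  rw [cov_sch_right h _ (hB.hasGaussianLaw_eval _).memLp_two, grd_mid]
  obtain ⟨k, j⟩ := p
  simp only at *
  have m1 := grd_mem (a := a) l hl k i hi
  have m2 := grd_mem (a := a) l hl k j hp.le
  have m3 := grd_mem (a := a) l hl k (j + 1) hp
  have m4 := grd_mono (a := a) l hl k j (j + 1) (by omega)
  rcases le_or_gt i j with hij | hij
  · have m5 := grd_mono (a := a) l hl k i j hij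
    rw [cov_B h _ _ m1.1 (by linarith) (by linarith), cov_B h _ _ m1.1 (by linarith) (by linarith),
      cov_B h _ _ m1.1 (by linarith) (by linarith)]
    field_simp
    ring
  · have m5 := grd_mono (a := a) l hl k (j + 1) i hij
    rw [covariance_comm, covariance_comm _ (B (grd a l k j)),
      covariance_comm _ (B (grd a l k (j + 1))),
      cov_B h _ _ (by linarith) (by linarith) m1.2, cov_B h _ _ (by linarith) (by linarith) m1.2,
      cov_B h _ _ (by linarith) (by linarith) m1.2]
    field_simp
    ring

lemma grd_succ_sub (l : ℝ) (k j : ℕ) : grd a l k (j + 1) = grd a l k j + l / 2 ^ k := by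
  unfold grd; push_cast; field_simp; ring

lemma sch_var (l : ℝ) (hl : 0 < l) (h : IsBrownianBridge 2 a (a + l) B) (p : ℕ × ℕ)
    (hp : p.2 < 2 ^ p.1) :
    Var[sch B a l p] = l / 2 ^ p.1 / 2 := by
  have hB := bb_process h
  have hS := sch_process (a := a) hB l
  have hm := fun t => (hB.hasGaussianLaw_eval t).memLp_two
  rw [← covariance_self (hS.hasGaussianLaw_eval p).aemeasurable,
    cov_sch_right h _ (hS.hasGaussianLaw_eval p).memLp_two,
    covariance_comm, covariance_comm _ (B (grd a l p.1 p.2)),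
      covariance_comm _ (B (grd a l p.1 (p.2 + 1))),
    cov_point l hl h p hp _ hp.le, cov_point l hl h p hp _ hp,
    cov_sch_right h _ (hm _), grd_mid, covariance_comm _ (B (grd a l p.1 p.2))]
  obtain ⟨k, j⟩ := p
  simp only at *
  have m2 := grd_mem (a := a) l hl k j hp.le
  have m3 := grd_mem (a := a) l hl k (j + 1) hp
  have m4 := grd_mono (a := a) l hl k j (j + 1) (by omega)
  rw [cov_B h _ _ (by linarith) (by linarith) (by linarith),
    cov_B h _ _ (by linarith) (by linarith) (by linarith),
    cov_B h _ _ (by linarith) (by linarith) (by linarith), grd_succ_sub,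
    add_sub_cancel_left]
  field_simp
  ring

lemma sch_mean (l : ℝ) (h : IsBrownianBridge 2 a b B) (p : ℕ × ℕ) :
    ∫ ω, sch B a l p ω = 0 := by
  have hB := bb_process h
  have hm := fun t => (hB.hasGaussianLaw_eval t).integrable
  unfold sch
  have h2 : Integrable (fun ω => (B (grd a l p.1 p.2) ω + B (grd a l p.1 (p.2 + 1)) ω) / 2) :=
    ((hm _).add (hm _)).div_const 2
  rw [integral_sub (hm _) h2, integral_div,
    integral_add (hm _) (hm _)]
  simp [h.mean_zero]

lemma sch_cov_aux (l : ℝ) (hl : 0 < l) (h : IsBrownianBridge 2 a (a + l) B) (p q : ℕ × ℕ)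
    (hp : p.2 < 2 ^ p.1) (hq : q.2 < 2 ^ q.1) (hpq : p ≠ q) (hle : p.1 ≤ q.1) :
    cov[sch B a l q, sch B a l p] = 0 := by
  have hB := bb_process h
  have hS := sch_process (a := a) hB l
  rw [cov_sch_right h _ (hS.hasGaussianLaw_eval q).memLp_two,
    covariance_comm, covariance_comm _ (B (grd a l p.1 p.2)),
      covariance_comm _ (B (grd a l p.1 (p.2 + 1)))]
  obtain ⟨k, j⟩ := p
  obtain ⟨k', j'⟩ := q
  simp only at *
  have c1 : cov[B (grd a l k j), sch B a l (k', j')] = 0 := by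
    obtain ⟨d, rfl⟩ := Nat.exists_eq_add_of_le hle
    rw [grd_refine l k d]
    apply cov_point l hl h (k + d, j') hq
    rw [pow_add, mul_comm]; gcongr
  have c2 : cov[B (grd a l k (j + 1)), sch B a l (k', j')] = 0 := by
    obtain ⟨d, rfl⟩ := Nat.exists_eq_add_of_le hle
    rw [grd_refine l k d]
    apply cov_point l hl h (k + d, j') hq
    rw [pow_add, mul_comm]; gcongr; exact hp
  have c3 : cov[B (grd a l (k + 1) (2 * j + 1)), sch B a l (k', j')] = 0 := by
    rcases Nat.lt_or_ge k k' with hlt | hge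
    · obtain ⟨d, rfl⟩ := Nat.exists_eq_add_of_le (show k + 1 ≤ k' from hlt)
      rw [grd_refine l (k + 1) d]
      apply cov_point l hl h (k + 1 + d, j') hq
      rw [pow_add, mul_comm]; gcongr
      rw [pow_succ]; omega
    · have : k = k' := le_antisymm hle hge
      subst this
      have hjj : j ≠ j' := fun hh => hpq (by rw [hh])
      -- direct computation through midpoints
      rw [cov_sch_right h _ (hB.hasGaussianLaw_eval _).memLp_two, grd_mid, grd_mid]
      have m1 := grd_mem (a := a) l hl k j hp.le
      have m1' := grd_mem (a := a) l hl k (j + 1) hp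
      have m2 := grd_mem (a := a) l hl k j' hq.le
      have m3 := grd_mem (a := a) l hl k (j' + 1) hq
      have m4 := grd_mono (a := a) l hl k j (j + 1) (by omega)
      have m5 := grd_mono (a := a) l hl k j' (j' + 1) (by omega)
      rcases Nat.lt_or_ge j j' with hlt | hge
      · have m6 := grd_mono (a := a) l hl k (j + 1) j' hlt
        rw [cov_B h _ _ (by linarith) (by linarith) (by linarith),
          cov_B h _ _ (by linarith) (by linarith) (by linarith),
          cov_B h _ _ (by linarith) (by linarith) (by linarith)]
        field_simp
        ring
      · have m6 := grd_mono (a := a) l hl k (j' + 1) j (by omega)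
        rw [covariance_comm, covariance_comm _ (B (grd a l k j')),
          covariance_comm _ (B (grd a l k (j' + 1))),
          cov_B h _ _ (by linarith) (by linarith) (by linarith),
          cov_B h _ _ (by linarith) (by linarith) (by linarith),
          cov_B h _ _ (by linarith) (by linarith) (by linarith)]
        field_simp
        ring
  rw [c1, c2, c3]; norm_num

lemma sch_indep (l : ℝ) (hl : 0 < l) (h : IsBrownianBridge 2 a (a + l) B) (n : ℕ) :
    iIndepFun (fun (p : Σ k : Fin n, Fin (2 ^ (k : ℕ))) =>
      sch B a l ((p.1 : ℕ), (p.2 : ℕ))) (volume : Measure Ω) := by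
  have hB := bb_process h
  have hS := (sch_process (a := a) hB l).comp_right
    (fun p : Σ k : Fin n, Fin (2 ^ (k : ℕ)) => ((p.1 : ℕ), (p.2 : ℕ)))
  apply HasGaussianLaw.iIndepFun_of_covariance_eq_zero
  · let L : (↥(Finset.univ : Finset (Σ k : Fin n, Fin (2 ^ (k : ℕ)))) → ℝ) →L[ℝ]
        ((Σ k : Fin n, Fin (2 ^ (k : ℕ))) → ℝ) :=
      ContinuousLinearMap.pi fun i => ContinuousLinearMap.proj ⟨i, Finset.mem_univ i⟩
    exact (hS.hasGaussianLaw Finset.univ).map L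
  · rintro ⟨⟨k, hk⟩, ⟨j, hj⟩⟩ ⟨⟨k', hk'⟩, ⟨j', hj'⟩⟩ hne
    have hne' : (k, j) ≠ (k', j') := by
      rintro hh
      obtain ⟨rfl, rfl⟩ := Prod.mk.inj hh
      exact hne rfl
    simp only at *
    rcases le_total k k' with hle | hle
    · rw [covariance_comm]
      exact sch_cov_aux l hl h (k, j) (k', j') hj hj' hne' hle
    · exact sch_cov_aux l hl h (k', j') (k, j) hj' hj hne'.symm hle

end bridge

section main
variable {Ω : Type} [MeasureSpace Ω] [IsProbabilityMeasure (volume : Measure Ω)]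
  {a : ℝ} {B : ℝ → Ω → ℝ}

/-- the target event at one coefficient -/
def evt (B : ℝ → Ω → ℝ) (a l : ℝ) (K : ℕ) (p : ℕ × ℕ) : Set Ω :=
  sch B a l p ⁻¹' Set.Icc ((l / 2 ^ p.1) ^ 2 / 4 - wid K p.1) ((l / 2 ^ p.1) ^ 2 / 4 + wid K p.1)

lemma sch_meas (l : ℝ) {b : ℝ} (h : IsBrownianBridge 2 a b B) (p : ℕ × ℕ) :
    Measurable (sch B a l p) := by
  have h1 := h.measurable (grd a l (p.1 + 1) (2 * p.2 + 1))
  have h2 := h.measurable (grd a l p.1 p.2)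
  have h3 := h.measurable (grd a l p.1 (p.2 + 1))
  exact h1.sub ((h2.add h3).div_const 2)

lemma evt_prob (l : ℝ) (hl : 0 < l) (h : IsBrownianBridge 2 a (a + l) B) (K : ℕ) (p : ℕ × ℕ)
    (hp : p.2 < 2 ^ p.1) (c : ℝ)
    (hc : c = 486 * (√(l / 2 ^ p.1 / 2) / wid K p.1) ∨
      c = 486 * (√(l / 2 ^ p.1 / 2) / wid K p.1) ^ 4) :
    ENNReal.ofReal (exp (-((l / 2 ^ p.1) ^ 3 / 16 + c))) ≤ volume (evt B a l K p) := by
  have hS := (sch_process (a := a) (bb_process h) l).hasGaussianLaw_eval p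
  have hlaw := hS.map_eq_gaussianReal
  rw [sch_mean l h p, sch_var l hl h p hp] at hlaw
  have hvpos : 0 < l / 2 ^ p.1 / 2 := by positivity
  set v : NNReal := (l / 2 ^ p.1 / 2).toNNReal with hv
  have hv' : (v : ℝ) = l / 2 ^ p.1 / 2 := Real.coe_toNNReal _ hvpos.le
  have hv0 : v ≠ 0 := by
    intro h0; rw [h0] at hv'; simp at hv'; linarith
  have hw := wid_pos K p.1
  have hsq : 0 < √(v : ℝ) := by rw [hv']; exact Real.sqrt_pos.2 hvpos
  have e : volume (evt B a l K p) = gaussianReal 0 v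
      (Set.Icc ((l / 2 ^ p.1) ^ 2 / 4 - wid K p.1) ((l / 2 ^ p.1) ^ 2 / 4 + wid K p.1)) := by
    rw [← hlaw, Measure.map_apply (sch_meas l h p) measurableSet_Icc, evt]
  rw [e, ← ofReal_measureReal]
  apply ENNReal.ofReal_le_ofReal
  refine le_trans ?_ (gr_shift v hv0 _ _ hw.le)
  have hsm := gr_small v hv0 (wid K p.1) (wid K p.1 / √(v : ℝ)) (by positivity) (by field_simp)
  rw [neg_add, Real.exp_add]
  have e1 : -((l / 2 ^ p.1) ^ 2 / 4) ^ 2 / (2 * (v : ℝ)) = -((l / 2 ^ p.1) ^ 3 / 16) := by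
    rw [hv']; field_simp; norm_num
  rw [e1]
  gcongr
  rw [hv'] at hsm
  rcases hc with rfl | rfl
  · have h1 := hsm.1
    rw [div_div_eq_mul_div, mul_div_assoc] at h1
    exact h1
  · have h1 := hsm.2
    rw [div_pow, div_div_eq_mul_div, mul_div_assoc, ← div_pow] at h1
    exact h1

lemma cost_sum (l : ℝ) (hl : 0 < l) (K : ℕ) (hK' : 2 ^ K ≤ l) (c : ℕ → ℝ)
    (hc2 : ∀ k, 2 ^ k * c k ≤ 486 * 40 ^ 4 * 2 ^ K * (4 / 5) ^ ((k - K) + (K - k))) (n : ℕ) :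
    ∑ k ∈ Finset.range n, (((2 ^ k : ℕ) : ℝ)) * ((l / 2 ^ k) ^ 3 / 16 + c k) ≤
      l ^ 3 / 12 + 486 * 40 ^ 4 * 10 * l := by
  have e : ∀ k, (((2 ^ k : ℕ) : ℝ)) * ((l / 2 ^ k) ^ 3 / 16 + c k)
      = l ^ 3 / 16 * (1 / 4) ^ k + 2 ^ k * c k := by
    intro k
    push_cast
    have h4 : ((1 : ℝ) / 4) ^ k = 1 / (2 ^ k) ^ 2 := by
      rw [div_pow, one_pow, ← pow_mul, mul_comm k 2, pow_mul]; norm_num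
    rw [h4]
    field_simp
  simp only [e]
  rw [Finset.sum_add_distrib, ← Finset.mul_sum]
  apply add_le_add
  · have := (summable_geometric_of_lt_one (r := (1 / 4 : ℝ)) (by norm_num) (by norm_num)).sum_le_tsum
      (Finset.range n) (fun i _ => by positivity)
    rw [tsum_geometric_of_lt_one (by norm_num) (by norm_num)] at this
    calc l ^ 3 / 16 * ∑ k ∈ Finset.range n, (1 / 4 : ℝ) ^ k
        ≤ l ^ 3 / 16 * (1 - 1 / 4)⁻¹ := by gcongr
      _ = l ^ 3 / 12 := by ring
  · calc ∑ k ∈ Finset.range n, 2 ^ k * c k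
        ≤ ∑ k ∈ Finset.range n, 486 * 40 ^ 4 * 2 ^ K * (4 / 5) ^ ((k - K) + (K - k)) :=
          Finset.sum_le_sum fun k _ => hc2 k
      _ = 486 * 40 ^ 4 * 2 ^ K * ∑ k ∈ Finset.range n, (4 / 5) ^ ((k - K) + (K - k)) := by
          rw [Finset.mul_sum]
      _ ≤ 486 * 40 ^ 4 * 2 ^ K * (2 / (1 - 4 / 5)) := by
          gcongr
          exact sum_two_sided _ (by norm_num) (by norm_num) K n
      _ = 486 * 40 ^ 4 * 10 * 2 ^ K := by ring
      _ ≤ _ := by gcongr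

lemma evt_meas_comap (l : ℝ) (K : ℕ) (p : ℕ × ℕ) :
    MeasurableSet[MeasurableSpace.comap (sch B a l p) inferInstance] (evt B a l K p) :=
  ⟨_, measurableSet_Icc, rfl⟩

lemma evt_prod_gen {ι : Type} [Fintype ι] (g : ι → ℕ × ℕ) (l : ℝ) (K : ℕ)
    (hi : iIndepFun (fun p : ι => sch B a l (g p)) (volume : Measure Ω)) :
    volume (⋂ p : ι, evt B a l K (g p)) = ∏ p : ι, volume (evt B a l K (g p)) := by
  have := hi.measure_inter_preimage_eq_mul Finset.univ
    (sets := fun p => Set.Icc ((l / 2 ^ (g p).1) ^ 2 / 4 - wid K (g p).1)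
      ((l / 2 ^ (g p).1) ^ 2 / 4 + wid K (g p).1)) (fun _ _ => measurableSet_Icc)
  simpa [evt] using this

lemma evt_prod (l : ℝ) (hl : 0 < l) (h : IsBrownianBridge 2 a (a + l) B) (K n : ℕ) :
    volume (⋂ p : Σ k : Fin n, Fin (2 ^ (k : ℕ)), evt B a l K ((p.1 : ℕ), (p.2 : ℕ)))
      = ∏ p : Σ k : Fin n, Fin (2 ^ (k : ℕ)), volume (evt B a l K ((p.1 : ℕ), (p.2 : ℕ))) :=
  evt_prod_gen (fun p : Σ k : Fin n, Fin (2 ^ (k : ℕ)) => ((p.1 : ℕ), (p.2 : ℕ))) l K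
    (sch_indep l hl h n)

lemma sum_levels (n : ℕ) (f : ℕ → ℝ) :
    ∑ p : Σ k : Fin n, Fin (2 ^ (k : ℕ)), f p.1 = ∑ k ∈ Finset.range n, ((2 ^ k : ℕ) : ℝ) * f k := by
  rw [Fintype.sum_sigma, ← Fin.sum_univ_eq_sum_range (fun k => ((2 ^ k : ℕ) : ℝ) * f k) n]
  apply Finset.sum_congr rfl
  intro k _
  show ∑ _y : Fin (2 ^ (k : ℕ)), f (k : ℕ) = _
  rw [Finset.sum_const, Finset.card_univ, Fintype.card_fin, nsmul_eq_mul]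

lemma evt_all (l : ℝ) (hl : 0 < l) (h : IsBrownianBridge 2 a (a + l) B) (K : ℕ)
    (hK : l ≤ 2 ^ (K + 1)) (hK' : 2 ^ K ≤ l) (n : ℕ) :
    ENNReal.ofReal (exp (-(l ^ 3 / 12 + 486 * 40 ^ 4 * 10 * l))) ≤
      volume (⋂ p : Σ k : Fin n, Fin (2 ^ (k : ℕ)), evt B a l K ((p.1 : ℕ), (p.2 : ℕ))) := by
  choose c hc1 hc2 using fun k => cost_level l hl K k hK
  have hsum := cost_sum l hl K hK' c hc2 n
  rw [evt_prod l hl h K n]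
  have step : ∀ p : Σ k : Fin n, Fin (2 ^ (k : ℕ)),
      ENNReal.ofReal (exp (-((l / 2 ^ (p.1 : ℕ)) ^ 3 / 16 + c p.1))) ≤
        volume (evt B a l K ((p.1 : ℕ), (p.2 : ℕ))) := fun p =>
    evt_prob l hl h K ((p.1 : ℕ), (p.2 : ℕ)) p.2.2 (c p.1) (hc1 p.1)
  refine le_trans ?_ (Finset.prod_le_prod' (fun p _ => step p))
  rw [← ENNReal.ofReal_prod_of_nonneg (fun _ _ => (Real.exp_pos _).le), ← Real.exp_sum]
  apply ENNReal.ofReal_le_ofReal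
  apply Real.exp_le_exp.2
  rw [Finset.sum_neg_distrib, neg_le_neg_iff,
    sum_levels n (fun k => (l / 2 ^ k) ^ 3 / 16 + c k)]
  exact hsum

lemma bridge_bound (l : ℝ) (hl : 1 ≤ l) (h : IsBrownianBridge 2 a (a + l) B) :
    ENNReal.ofReal (exp (-(l ^ 3 / 12 + 486 * 40 ^ 4 * 10 * l))) ≤
      volume {ω | ∀ s ∈ Set.Icc a (a + l), |B s ω - (s - a) * (a + l - s)| ≤ 1 / 2} := by
  have hl0 : 0 < l := by linarith
  obtain ⟨K, hK', hK⟩ := exists_nat_pow_near hl (by norm_num : (1 : ℝ) < 2)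
  set E : ℕ → Set Ω := fun n =>
    ⋂ p : Σ k : Fin n, Fin (2 ^ (k : ℕ)), evt B a l K ((p.1 : ℕ), (p.2 : ℕ)) with hE
  have hEmem : ∀ n ω, ω ∈ E n ↔ ∀ k < n, ∀ j < 2 ^ k, ω ∈ evt B a l K (k, j) := by
    intro n ω
    simp only [hE, Set.mem_iInter]
    constructor
    · intro hh k hk j hj
      exact hh ⟨⟨k, hk⟩, ⟨j, hj⟩⟩
    · rintro hh ⟨⟨k, hk⟩, ⟨j, hj⟩⟩
      exact hh k hk j hj
  have hanti : Antitone E := by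
    intro n m hnm ω hω
    rw [hEmem] at *
    exact fun k hk => hω k (by omega)
  have hmeas : ∀ n, MeasurableSet (E n) := fun n =>
    MeasurableSet.iInter fun p => sch_meas l h _ measurableSet_Icc
  have hlim := tendsto_measure_iInter_atTop (μ := (volume : Measure Ω))
    (fun n => (hmeas n).nullMeasurableSet) hanti ⟨0, measure_ne_top _ _⟩
  have hge := ge_of_tendsto' hlim (fun n => evt_all l hl0 h K hK.le hK' n)
  refine hge.trans (measure_mono ?_)
  intro ω hω
  rw [Set.mem_iInter] at hω
  apply det_cont (fun s => B s ω - (s - a) * (a + l - s)) _ a l (1 / 2) hl0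
  · intro n i hi
    refine le_trans (det_grid (fun s => B s ω - (s - a) * (a + l - s)) a l (wid K)
      (fun k => (wid_pos K k).le) ?_ ?_ n ?_ i hi) (wid_sum K n)
    · simp [h.endpoint_left]
    · simp [h.endpoint_right]
    · intro k hk j hj
      have := (hEmem n ω).1 (hω n) k hk j hj
      simp only [evt, Set.mem_preimage, Set.mem_Icc, sch] at this
      have e : (grd a l (k + 1) (2 * j + 1) - a) * (a + l - grd a l (k + 1) (2 * j + 1))
          - ((grd a l k j - a) * (a + l - grd a l k j)
            + (grd a l k (j + 1) - a) * (a + l - grd a l k (j + 1))) / 2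
          = (l / 2 ^ k) ^ 2 / 4 := by
        rw [grd_mid, grd_succ_sub]; ring
      rw [abs_le]
      constructor <;> linarith [this.1, this.2]
  · have := h.cont ω
    fun_prop

end main

/-- Let `z₁ < z₂` and let `B` be a rate two Brownian bridge on `[z₁, z₂]` whose endpoint
values `x, y` are at least `−z₁²+1` and `−z₂²+1` respectively (realized as a zero-endpoint
rate two bridge `B₀` plus the linear interpolation of `(x,y)`).  Then, for all `z₂ − z₁`
sufficiently large,
`P(B(s) > −s² ∀ s ∈ [z₁,z₂]) ≥ exp(−(1/12)(z₂−z₁)³ − 2(z₂−z₁)·log(z₂−z₁))`. -/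
theorem parabola_avoidance_lower_bound :
    ∃ L : ℝ, ∀ z₁ z₂ x y : ℝ, z₁ < z₂ → L ≤ z₂ - z₁ →
      -z₁ ^ 2 + 1 ≤ x → -z₂ ^ 2 + 1 ≤ y →
      ∀ {Ω : Type} [MeasureSpace Ω] [IsProbabilityMeasure (volume : Measure Ω)]
        (B₀ : ℝ → Ω → ℝ), IsBrownianBridge 2 z₁ z₂ B₀ →
      ENNReal.ofReal (Real.exp (-(1 / 12) * (z₂ - z₁) ^ 3 -
          2 * (z₂ - z₁) * Real.log (z₂ - z₁))) ≤
        volume {ω | ∀ s ∈ Set.Icc z₁ z₂,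
          -s ^ 2 < B₀ s ω + ((z₂ - s) / (z₂ - z₁) * x + (s - z₁) / (z₂ - z₁) * y)} := by
  refine ⟨exp (486 * 40 ^ 4 * 10), ?_⟩
  intro z₁ z₂ x y hz hL hx hy Ω _ _ B₀ hB
  obtain ⟨l, rfl⟩ : ∃ l, z₂ = z₁ + l := ⟨z₂ - z₁, by ring⟩
  simp only [add_sub_cancel_left] at hL ⊢
  have hl1 : 1 ≤ l := le_trans (Real.one_le_exp (by norm_num)) hL
  have hl0 : 0 < l := by linarith
  have hlog : 486 * 40 ^ 4 * 10 ≤ Real.log l := (Real.le_log_iff_exp_le hl0).2 hL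
  refine le_trans (ENNReal.ofReal_le_ofReal (Real.exp_le_exp.2 ?_))
    ((bridge_bound l hl1 hB).trans (measure_mono ?_))
  · nlinarith
  · intro ω hω s hs
    have h1 := (abs_le.1 (hω s hs)).1
    have h2 : (z₁ + l - s) / l * (-z₁ ^ 2 + 1) ≤ (z₁ + l - s) / l * x :=
      mul_le_mul_of_nonneg_left hx (div_nonneg (by linarith [hs.2]) hl0.le)
    have h3 : (s - z₁) / l * (-(z₁ + l) ^ 2 + 1) ≤ (s - z₁) / l * y :=
      mul_le_mul_of_nonneg_left hy (div_nonneg (by linarith [hs.1]) hl0.le)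
    have e : (z₁ + l - s) / l * (-z₁ ^ 2 + 1) + (s - z₁) / l * (-(z₁ + l) ^ 2 + 1)
        = -s ^ 2 - (s - z₁) * (z₁ + l - s) + 1 := by
      field_simp
      ring
    linarith
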